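/- Let P be a finite nonempty subset of a metric space M, let k, ℓ be integers with 1 ≤ ℓ ≤ k ≤ |P| and ℓ dividing k, and set m = k/ℓ, with m ≥ 2. Let q_1, …, q_m be a Gonzalez sequence in P, and let C ⊆ P be such that for every i, C contains at least ℓ points of P each within distance dist_ℓ(P, q_i) of q_i (equivalently, dist_ℓ(C, q_i) = dist_ℓ(P, q_i)). Then max_{p ∈ P} dist_ℓ(C, p) ≤ 3·r_opt, where r_opt is the optimal fault-tolerant k-center cost of P with fault-tolerance parameter ℓ. -/

import Mathlib

/-- `kthDist S p i` is the `i`-th smallest value (1-indexed) among the distances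
`dist p s` for `s ∈ S`, i.e. the radius of the smallest closed ball centered at `p`
containing at least `i` points of `S`. -/
noncomputable def kthDist {M : Type*} [MetricSpace M] (S : Finset M) (p : M) (i : ℕ) : ℝ :=
  ((S.val.map (fun s => dist p s)).sort (· ≤ ·)).getD (i - 1) 0

theorem List.getD_le_iff_lt_countP {α : Type*} [LinearOrder α] {L : List α}
    (hL : L.Pairwise (· ≤ ·)) {n : ℕ} (hn : n < L.length) (r d : α) :
    L.getD n d ≤ r ↔ n < L.countP (fun x => x ≤ r) := by
  induction L generalizing n with
  | nil => simp at hn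
  | cons a L ih =>
    rw [List.pairwise_cons] at hL
    by_cases ha : a ≤ r
    · rw [List.countP_cons_of_pos (by simpa using ha)]
      cases n with
      | zero => simpa using ha
      | succ n =>
        rw [List.getD_cons_succ, ih hL.2 (by simpa using hn)]
        omega
    · have hzero : (a :: L).countP (fun x => x ≤ r) = 0 := by
        rw [List.countP_eq_zero]
        intro x hx
        rcases List.mem_cons.1 hx with rfl | hx
        · simpa using ha
        · simpa using (not_le.1 ha).trans_le (hL.1 x hx)
      rw [hzero, List.getD_eq_getElem _ _ hn]
      simp only [not_lt_zero, iff_false, not_le]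
      rcases List.mem_cons.1 (List.getElem_mem hn) with h | h
      · rw [h]; exact not_le.1 ha
      · exact (not_le.1 ha).trans_le (hL.1 _ h)

theorem kthDist_le_iff {M : Type*} [MetricSpace M] {S : Finset M} {i : ℕ}
    (hi : 1 ≤ i) (hS : i ≤ S.card) (p : M) (r : ℝ) :
    kthDist S p i ≤ r ↔ i ≤ (S.filter (fun x => dist p x ≤ r)).card := by
  have hsort := Multiset.pairwise_sort (S.val.map (fun s => dist p s)) (· ≤ ·)
  have hcount : ((S.val.map (fun s => dist p s)).sort (· ≤ ·)).countP (fun x => x ≤ r) =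
      (S.filter (fun x => dist p x ≤ r)).card := by
    rw [← Multiset.coe_countP, Multiset.sort_eq, Multiset.countP_map]
    rfl
  rw [kthDist, List.getD_le_iff_lt_countP hsort (by simp; omega), hcount]
  omega

/-- If the closed `r`-balls around the points `f i` each contain at least `ℓ` points of `S`, and
the points are pairwise more than `2 * r` apart, then `S` has at least `ℓ` points for each index. -/
theorem card_mul_le_card_of_separated {ι M : Type*} [MetricSpace M] [DecidableEq M]
    {I : Finset ι} {S : Finset M} {f : ι → M} {r : ℝ} {ℓ : ℕ}
    (hball : ∀ i ∈ I, ℓ ≤ (S.filter (fun x => dist (f i) x ≤ r)).card)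
    (hsep : (I : Set ι).Pairwise fun i j => 2 * r < dist (f i) (f j)) :
    I.card * ℓ ≤ S.card := by
  calc I.card * ℓ ≤ ∑ i ∈ I, (S.filter (fun x => dist (f i) x ≤ r)).card := by
        simpa using Finset.card_nsmul_le_sum I _ ℓ hball
    _ = (I.biUnion fun i => S.filter (fun x => dist (f i) x ≤ r)).card := by
        refine (Finset.card_biUnion fun i hi j hj hij => ?_).symm
        rw [Function.onFun, Finset.disjoint_left]
        intro x hx hx'
        have h := hsep hi hj hij
        have := dist_triangle_right (f i) (f j) x
        linarith [(Finset.mem_filter.1 hx).2, (Finset.mem_filter.1 hx').2]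
    _ ≤ S.card := Finset.card_le_card (Finset.biUnion_subset.2 fun i _ => Finset.filter_subset _ _)

/-- Let `P` be a finite nonempty subset of a metric space,
`1 ≤ ℓ ≤ k ≤ |P|` with `ℓ ∣ k`, and `m = k/ℓ ≥ 2`.  Let `q 1, …, q m` be a Gonzalez
sequence in `P`, and let `C ⊆ P` be such that for every `i`, `C` contains at least `ℓ`
points of `P` each within distance `dist_ℓ(P, q i)` of `q i`.  Then
`max_{p ∈ P} dist_ℓ(C, p) ≤ 3·r_opt`, where `r_opt` is the optimal fault-tolerant
`k`-center cost of `P` with fault-tolerance parameter `ℓ`. -/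
theorem gonzalez_three_approx_of_dvd {M : Type*} [MetricSpace M] [DecidableEq M]
    (P : Finset M) (hP : P.Nonempty) (k ℓ : ℕ)
    (hl1 : 1 ≤ ℓ) (hlk : ℓ ≤ k) (hkP : k ≤ P.card) (hdvd : ℓ ∣ k)
    (m : ℕ) (hmdef : m = k / ℓ) (hm : 2 ≤ m)
    (ropt : ℝ)
    (hopt : IsLeast {x : ℝ | ∃ C' : Finset M, C' ⊆ P ∧ C'.card = k ∧
      x = P.sup' hP (fun p => kthDist C' p ℓ)} ropt)
    (q : ℕ → M) (hq1 : q 1 ∈ P)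
    (hgonz : ∀ i, 2 ≤ i → i ≤ m → q i ∈ P ∧
      ∀ p ∈ P, Metric.infDist p (((Finset.Icc 1 (i - 1)).image q : Finset M) : Set M) ≤
        Metric.infDist (q i) (((Finset.Icc 1 (i - 1)).image q : Finset M) : Set M))
    (C : Finset M) (hCP : C ⊆ P)
    (hC : ∀ i, 1 ≤ i → i ≤ m →
      ℓ ≤ (C.filter (fun x => dist (q i) x ≤ kthDist P (q i) ℓ)).card) :
    P.sup' hP (fun p => kthDist C p ℓ) ≤ 3 * ropt := by
  obtain ⟨⟨D, hDP, hDk, rfl⟩, -⟩ := hopt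
  set r := P.sup' hP (fun p => kthDist D p ℓ)
  have hqP : ∀ i, 1 ≤ i → i ≤ m → q i ∈ P := by
    intro i hi him
    rcases hi.eq_or_lt with rfl | hi
    · exact hq1
    · exact (hgonz i hi him).1
  have hball : ∀ p ∈ P, ℓ ≤ (D.filter (fun x => dist p x ≤ r)).card := fun p hp =>
    (kthDist_le_iff hl1 (hDk ▸ hlk) p r).1 (Finset.le_sup' (fun p => kthDist D p ℓ) hp)
  have hPr : ∀ p ∈ P, kthDist P p ℓ ≤ r := fun p hp =>
    (kthDist_le_iff hl1 (hlk.trans hkP) p r).2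
      ((hball p hp).trans (Finset.card_le_card (Finset.filter_subset_filter _ hDP)))
  have hcover : ∀ p ∈ P, ∃ i, 1 ≤ i ∧ i ≤ m ∧ dist p (q i) ≤ 2 * r := by
    intro p hp
    by_contra! hfar
    have hqsep : ∀ i j, 1 ≤ i → i < j → j ≤ m → 2 * r < dist (q j) (q i) := by
      intro i j hi hij hjm
      have hmem : q i ∈ (((Finset.Icc 1 (j - 1)).image q : Finset M) : Set M) := by
        simp only [Finset.coe_image, Finset.coe_Icc]
        exact ⟨i, ⟨hi, by omega⟩, rfl⟩
      obtain ⟨y, hy, hpy⟩ :=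
        (Finset.finite_toSet ((Finset.Icc 1 (j - 1)).image q)).isCompact.exists_infDist_eq_dist
          ⟨_, hmem⟩ p
      simp only [Finset.coe_image, Finset.coe_Icc] at hy
      obtain ⟨a, ⟨ha, haj⟩, rfl⟩ := hy
      calc 2 * r < dist p (q a) := hfar a ha (by omega)
        _ = _ := hpy.symm
        _ ≤ _ := (hgonz j (by omega) hjm).2 p hp
        _ ≤ dist (q j) (q i) := Metric.infDist_le_dist_of_mem hmem
    have hcard : (Finset.range (m + 1)).card * ℓ ≤ D.card := by
      refine card_mul_le_card_of_separated (f := fun i => if i = 0 then p else q i) (r := r) ?_ ?_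
      · intro i hi
        rw [Finset.mem_range] at hi
        apply hball
        split_ifs with h
        · exact hp
        · exact hqP i (by omega) (by omega)
      · intro i hi j hj hij
        simp only [Finset.coe_range, Set.mem_Iio] at hi hj
        split_ifs with h h' h'
        · omega
        · exact hfar j (by omega) (by omega)
        · rw [dist_comm]
          exact hfar i (by omega) (by omega)
        · rcases lt_or_gt_of_ne hij with h'' | h''
          · rw [dist_comm]
            exact hqsep i j (by omega) h'' (by omega)
          · exact hqsep j i (by omega) h'' (by omega)
    rw [Finset.card_range, hDk, add_mul, hmdef, Nat.div_mul_cancel hdvd] at hcard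
    omega
  refine Finset.sup'_le _ _ fun p hp => ?_
  obtain ⟨i, hi, him, hpi⟩ := hcover p hp
  have hCi := hC i hi him
  refine (kthDist_le_iff hl1 (hCi.trans (Finset.card_filter_le _ _)) p _).2
    (hCi.trans (Finset.card_le_card (Finset.monotone_filter_right _ ?_)))
  intro x _ hx
  linarith [dist_triangle p (q i) x, hPr _ (hqP i hi him)]
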